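/- Multivariate Bayesian Cramér–Rao (van Trees) inequality: Let W ⊂ ℝ^d be compact, let π be a C¹ probability density on ℝ^d supported on W that vanishes on the boundary of W, and let {f_w : w ∈ ℝ^d} be a family of probability densities on a measurable sample space 𝒳, differentiable in w. Define the Fisher information matrix 𝓘(w) = ∫_𝒳 (∇_w ln f_w(x))(∇_w ln f_w(x))ᵀ f_w(x) dx and the prior information matrix 𝓘(π) = ∫ (∇ ln π(w))(∇ ln π(w))ᵀ π(w) dw. Assume the regularity conditions: for all i, differentiation under the integral sign gives ∂/∂w_i ∫_𝒳 f_w(x) dx = 0; for all i, j, the integration-by-parts identity ∫∫ ∂/∂w_j [(ŵ_i(x) − w_i) f_w(x) π(w)] dx dw = 0 holds; all displayed integrals are finite; and E_{w∼π} 𝓘(w) + 𝓘(π) is invertible. Then for any measurable estimator ŵ : 𝒳 → ℝ^d, E_{w∼π} E_{X∼f_w} [(ŵ(X) − w)(ŵ(X) − w)ᵀ] ⪰ (E_{w∼π} 𝓘(w) + 𝓘(π))^{-1}. -/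

import Mathlib

open Matrix MeasureTheory
noncomputable section

lemma vt_psd {d : ℕ} {Ω : Type*} [MeasurableSpace Ω] (ν : Measure Ω)
    (A S : Fin d → Ω → ℝ) (hA : ∀ i, MemLp (A i) 2 ν) (hS : ∀ i, MemLp (S i) 2 ν)
    (M J : Matrix (Fin d) (Fin d) ℝ)
    (hM : ∀ i j, ∫ z, A i z * A j z ∂ν = M i j)
    (hJ : ∀ i j, ∫ z, S i z * S j z ∂ν = J i j)
    (hAS : ∀ i j, ∫ z, A i z * S j z ∂ν = if i = j then 1 else 0)
    (hu : IsUnit J) : (M - J⁻¹).PosSemidef := by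
  have hMs : M.IsHermitian := by
    ext i j
    simp only [conjTranspose_apply, star_trivial, ← hM]
    exact integral_congr_ae (Filter.Eventually.of_forall fun z => mul_comm _ _)
  have hJs : J.IsHermitian := by
    ext i j
    simp only [conjTranspose_apply, star_trivial, ← hJ]
    exact integral_congr_ae (Filter.Eventually.of_forall fun z => mul_comm _ _)
  refine PosSemidef.of_dotProduct_mulVec_nonneg (hMs.sub hJs.inv) fun v => ?_
  set u := J⁻¹ *ᵥ v with hudef
  have hJu : J *ᵥ u = v := by
    rw [hudef, mulVec_mulVec, Matrix.mul_nonsing_inv _ ((Matrix.isUnit_iff_isUnit_det J).1 hu),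
      one_mulVec]
  have iAA i j : Integrable (fun z => A i z * A j z) ν := (hA i).integrable_mul (hA j)
  have iAS i j : Integrable (fun z => A i z * S j z) ν := (hA i).integrable_mul (hS j)
  have iSS i j : Integrable (fun z => S i z * S j z) ν := (hS i).integrable_mul (hS j)
  have key : ∫ z, (∑ i, (v i * A i z - u i * S i z))^2 ∂ν
      = ∑ i, ∑ j, (v i * v j * M i j - v i * u j * (if i = j then 1 else 0)
        - u i * v j * (if j = i then 1 else 0) + u i * u j * J i j) := by
    have e : ∀ z, (∑ i, (v i * A i z - u i * S i z))^2 = ∑ i, ∑ j,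
        (v i * v j * (A i z * A j z) - v i * u j * (A i z * S j z)
          - u i * v j * (A j z * S i z) + u i * u j * (S i z * S j z)) := by
      intro z
      rw [sq, Finset.sum_mul_sum]
      refine Finset.sum_congr rfl fun i _ => Finset.sum_congr rfl fun j _ => ?_
      ring
    simp_rw [e]
    have i1 i j : Integrable (fun z => v i * v j * (A i z * A j z)) ν := (iAA i j).const_mul _
    have i2 i j : Integrable (fun z => v i * u j * (A i z * S j z)) ν := (iAS i j).const_mul _
    have i3 i j : Integrable (fun z => u i * v j * (A j z * S i z)) ν := (iAS j i).const_mul _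
    have i4 i j : Integrable (fun z => u i * u j * (S i z * S j z)) ν := (iSS i j).const_mul _
    have i5 i j : Integrable (fun z => v i * v j * (A i z * A j z) - v i * u j * (A i z * S j z)
          - u i * v j * (A j z * S i z) + u i * u j * (S i z * S j z)) ν :=
      (((i1 i j).sub (i2 i j)).sub (i3 i j)).add (i4 i j)
    rw [integral_finsetSum _ fun i _ => integrable_finsetSum _ fun j _ => i5 i j]
    refine Finset.sum_congr rfl fun i _ => ?_
    rw [integral_finsetSum _ fun j _ => i5 i j]
    refine Finset.sum_congr rfl fun j _ => ?_
    have i12 : Integrable (fun z => v i * v j * (A i z * A j z) - v i * u j * (A i z * S j z)) ν :=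
      (i1 i j).sub (i2 i j)
    have i123 : Integrable (fun z => v i * v j * (A i z * A j z) - v i * u j * (A i z * S j z)
        - u i * v j * (A j z * S i z)) ν := i12.sub (i3 i j)
    rw [integral_add i123 (i4 i j), integral_sub i12 (i3 i j), integral_sub (i1 i j) (i2 i j)]
    simp only [integral_const_mul, hM, hJ, hAS]
  have hpos : 0 ≤ ∫ z, (∑ i, (v i * A i z - u i * S i z))^2 ∂ν :=
    integral_nonneg fun z => sq_nonneg _
  rw [key] at hpos
  have e1 : ∑ i, ∑ j, v i * v j * M i j = v ⬝ᵥ (M *ᵥ v) := by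
    simp only [dotProduct, mulVec, Finset.mul_sum]
    exact Finset.sum_congr rfl fun i _ => Finset.sum_congr rfl fun j _ => by ring
  have e2 : ∑ i, ∑ j, u i * u j * J i j = u ⬝ᵥ v := by
    conv_rhs => rw [← hJu]
    simp only [dotProduct, mulVec, Finset.mul_sum]
    exact Finset.sum_congr rfl fun i _ => Finset.sum_congr rfl fun j _ => by ring
  simp only [Finset.sum_add_distrib, Finset.sum_sub_distrib, e1, e2] at hpos
  simp only [star_trivial, sub_mulVec, dotProduct_sub, ← hudef]
  have e3 : ∑ i, ∑ j, v i * u j * (if i = j then (1:ℝ) else 0) = v ⬝ᵥ u := by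
    simp [dotProduct]
  have e4 : ∑ i, ∑ j, u i * v j * (if j = i then (1:ℝ) else 0) = u ⬝ᵥ v := by
    simp [dotProduct]
  rw [e3, e4] at hpos
  linarith

lemma vt_meas_deriv {d : ℕ} {𝒳 : Type*} [MeasurableSpace 𝒳]
    (f : EuclideanSpace ℝ (Fin d) → 𝒳 → ℝ)
    (hm : Measurable (fun z : EuclideanSpace ℝ (Fin d) × 𝒳 => f z.1 z.2))
    (hd : ∀ x, Differentiable ℝ (fun w => f w x)) (v : EuclideanSpace ℝ (Fin d)) :
    Measurable (fun z : EuclideanSpace ℝ (Fin d) × 𝒳 => fderiv ℝ (fun w => f w z.2) z.1 v) := by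
  refine measurable_of_tendsto_metrizable (f := fun (n : ℕ) (z : EuclideanSpace ℝ (Fin d) × 𝒳) =>
    (n : ℝ) • (f (z.1 + (n : ℝ)⁻¹ • v) z.2 - f z.1 z.2)) (fun n => ?_) ?_
  · have h1 : Measurable (fun z : EuclideanSpace ℝ (Fin d) × 𝒳 =>
        f (z.1 + (n : ℝ)⁻¹ • v) z.2) :=
      hm.comp ((measurable_fst.add_const _).prodMk measurable_snd)
    exact (h1.sub hm).const_smul (n : ℝ)
  · rw [tendsto_pi_nhds]
    intro z
    refine ((hd z.2 z.1).hasFDerivAt).lim v (c := fun n : ℕ => (n : ℝ)) (l := Filter.atTop) ?_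
    simpa using tendsto_natCast_atTop_atTop (R := ℝ)

lemma vt_fderiv_zero {d : ℕ} (h : EuclideanSpace ℝ (Fin d) → ℝ) (h0 : ∀ w, 0 ≤ h w)
    (w : EuclideanSpace ℝ (Fin d)) (hw : h w = 0) : fderiv ℝ h w = 0 := by
  apply IsLocalMin.fderiv_eq_zero
  exact Filter.Eventually.of_forall fun y => by simpa [hw] using h0 y

lemma vt_gradlog {d : ℕ} (h : EuclideanSpace ℝ (Fin d) → ℝ) 
    (w : EuclideanSpace ℝ (Fin d)) (hd : DifferentiableAt ℝ h w) (i j : Fin d) :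
    gradient (fun w' => Real.log (h w')) w i * gradient (fun w' => Real.log (h w')) w j * h w
    = fderiv ℝ h w (EuclideanSpace.single i 1) * fderiv ℝ h w (EuclideanSpace.single j 1)
      / h w := by
  by_cases hw : h w = 0
  · simp [hw]
  have key : ∀ k, gradient (fun w' => Real.log (h w')) w k
      = (h w)⁻¹ * fderiv ℝ h w (EuclideanSpace.single k 1) := by
    intro k
    have h1 : gradient (fun w' => Real.log (h w')) w k
      = inner ℝ (gradient (fun w' => Real.log (h w')) w) (EuclideanSpace.single k 1) := by
      rw [EuclideanSpace.inner_single_right]; simp only [one_mul, conj_trivial]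
    rw [h1, gradient, InnerProductSpace.toDual_symm_apply, fderiv.log hd hw]
    simp
  rw [key, key]
  field_simp

lemma vt_sfin {ι 𝒳 : Type*} [Countable ι] [MeasurableSpace 𝒳] (μ : Measure 𝒳)
    (g : ι → 𝒳 → ℝ) (hg : ∀ n, Integrable (g n) μ) (hm : ∀ n, Measurable (g n)):
    SigmaFinite (μ.restrict (⋃ n, {x | g n x ≠ 0})) := by
  set S := ⋃ n, {x | g n x ≠ 0}
  have hS : MeasurableSet S := MeasurableSet.iUnion fun n => hm n (measurableSet_singleton 0).compl
  refine Measure.sigmaFinite_of_countable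
    (S := insert Sᶜ (Set.range fun p : ι × ℕ => {x | 1 / ((p.2:ℝ) + 1) ≤ ‖g p.1 x‖})) ?_ ?_ ?_
  · exact (Set.countable_range _).insert _
  · rintro s (rfl | ⟨p, rfl⟩)
    · rw [Measure.restrict_apply hS.compl]; simp
    · exact (Measure.restrict_apply_le _ _).trans_lt
        ((hg p.1).measure_norm_ge_lt_top (by positivity))
  · rw [Set.eq_univ_iff_forall]
    intro x
    by_cases hx : x ∈ S
    · obtain ⟨n, hn⟩ := Set.mem_iUnion.1 hx
      obtain ⟨k, hk⟩ := exists_nat_one_div_lt (norm_pos_iff.2 hn)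
      exact ⟨_, Or.inr ⟨(n, k), rfl⟩, hk.le⟩
    · exact ⟨_, Or.inl rfl, hx⟩

lemma vt_int_prod {d : ℕ} {𝒳 : Type*} [MeasurableSpace 𝒳] (μ : Measure 𝒳) [SigmaFinite μ]
    (G : EuclideanSpace ℝ (Fin d) → 𝒳 → ℝ)
    (hm : Measurable (fun z : EuclideanSpace ℝ (Fin d) × 𝒳 => G z.1 z.2))
    (h0 : ∀ w x, 0 ≤ G w x) (hi : ∀ w, Integrable (G w) μ)
    (hI : Integrable (fun w => ∫ x, G w x ∂μ)) :
    Integrable (fun z : EuclideanSpace ℝ (Fin d) × 𝒳 => G z.1 z.2) (volume.prod μ) := by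
  rw [integrable_prod_iff hm.aestronglyMeasurable]
  refine ⟨Filter.Eventually.of_forall hi, ?_⟩
  simpa only [Real.norm_of_nonneg (h0 _ _)] using hI

lemma vt_score {d : ℕ} {𝒳 : Type*} [MeasurableSpace 𝒳] (μ : Measure 𝒳) [SigmaFinite μ]
    (p : EuclideanSpace ℝ (Fin d) → ℝ) (hp : ContDiff ℝ 1 p)
    (f : EuclideanSpace ℝ (Fin d) → 𝒳 → ℝ)
    (hfm : Measurable (fun z : EuclideanSpace ℝ (Fin d) × 𝒳 => f z.1 z.2))
    (hf0 : ∀ w x, 0 ≤ f w x) (hfi : ∀ w, Integrable (f w) μ)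
    (hf1 : ∀ w, ∫ x, f w x ∂μ = 1)
    (hd : ∀ x, Differentiable ℝ (fun w => f w x)) (v : EuclideanSpace ℝ (Fin d))
    (hD : Integrable (fun z : EuclideanSpace ℝ (Fin d) × 𝒳 =>
      fderiv ℝ (fun w => f w z.2) z.1 v * p z.1) (volume.prod μ)) :
    ∀ᵐ w, ∫ x, fderiv ℝ (fun w' => f w' x) w v * p w ∂μ = 0 := by
  apply ae_eq_zero_of_integral_contDiff_smul_eq_zero
  · exact hD.integral_prod_left.locallyIntegrable
  intro g hg hgc
  -- the test function
  have hh : ContDiff ℝ 1 (fun w => g w * p w) := (hg.of_le (by simp)).mul hp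
  have hhc : HasCompactSupport (fun w => g w * p w) := hgc.mul_right
  set h := fun w => g w * p w with hdef
  have hh' : Continuous (fun w => fderiv ℝ h w v) :=
    (hh.continuous_fderiv (by simp)).clm_apply continuous_const
  have hhc' : HasCompactSupport (fun w => fderiv ℝ h w v) := hhc.fderiv_apply (𝕜 := ℝ) v
  have iB : Integrable (fun z : EuclideanSpace ℝ (Fin d) × 𝒳 =>
      fderiv ℝ h z.1 v * f z.1 z.2) (volume.prod μ) := by
    have hms : Measurable (fun z : EuclideanSpace ℝ (Fin d) × 𝒳 =>
        fderiv ℝ h z.1 v * f z.1 z.2) := (hh'.measurable.comp measurable_fst).mul hfm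
    rw [integrable_prod_iff hms.aestronglyMeasurable]
    refine ⟨Filter.Eventually.of_forall fun w => (hfi w).const_mul (fderiv ℝ h w v), ?_⟩
    have : ∀ w, ∫ x, ‖fderiv ℝ h w v * f w x‖ ∂μ = ‖fderiv ℝ h w v‖ := by
      intro w
      simp only [norm_mul, Real.norm_of_nonneg (hf0 _ _)]
      rw [integral_const_mul, hf1, mul_one]
    simp only [this]
    exact (hh'.integrable_of_hasCompactSupport hhc').norm
  obtain ⟨C, hC⟩ := hgc.exists_bound_of_continuous hg.continuous
  have iA : Integrable (fun z : EuclideanSpace ℝ (Fin d) × 𝒳 =>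
      h z.1 * fderiv ℝ (fun w => f w z.2) z.1 v) (volume.prod μ) := by
    have := hD.bdd_mul (c := C) (f := fun z => g z.1)
      (hg.continuous.measurable.comp measurable_fst).aestronglyMeasurable
      (Filter.Eventually.of_forall fun z => hC z.1)
    refine this.congr (Filter.Eventually.of_forall fun z => ?_)
    simp only [hdef]; ring
  have e1 : ∫ w, g w • ∫ x, fderiv ℝ (fun w' => f w' x) w v * p w ∂μ
      = ∫ w, ∫ x, h w * fderiv ℝ (fun w' => f w' x) w v ∂μ := by
    refine integral_congr_ae (Filter.Eventually.of_forall fun w => ?_)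
    simp only [smul_eq_mul]
    rw [← integral_const_mul]
    refine integral_congr_ae (Filter.Eventually.of_forall fun x => ?_)
    simp only [hdef]; ring
  have e2 : ∫ w, ∫ x, h w * fderiv ℝ (fun w' => f w' x) w v ∂μ
      = ∫ x, (∫ w, h w * fderiv ℝ (fun w' => f w' x) w v) ∂μ := integral_integral_swap iA
  have e3 : ∫ x, (∫ w, h w * fderiv ℝ (fun w' => f w' x) w v) ∂μ
      = ∫ x, (- ∫ w, fderiv ℝ h w v * f w x) ∂μ := by
    refine integral_congr_ae ?_
    filter_upwards [iA.prod_left_ae] with x hx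
    refine integral_mul_fderiv_eq_neg_fderiv_mul_of_integrable ?_ hx ?_ ?_ ?_
    · exact (hh'.mul (hd x).continuous).integrable_of_hasCompactSupport hhc'.mul_right
    · exact (hh.continuous.mul (hd x).continuous).integrable_of_hasCompactSupport hhc.mul_right
    · exact fun w _ => hh.differentiable (by simp) w
    · exact fun w _ => hd x w
  have e4 : ∫ x, (∫ w, fderiv ℝ h w v * f w x) ∂μ = ∫ w, ∫ x, fderiv ℝ h w v * f w x ∂μ :=
    (integral_integral_swap iB).symm
  have e5 : ∫ w, ∫ x, fderiv ℝ h w v * f w x ∂μ = ∫ w, fderiv ℝ h w v := by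
    simp only [integral_const_mul, hf1, mul_one]
  have e6 : ∫ w, fderiv ℝ h w v = 0 := by
    have := integral_mul_fderiv_eq_neg_fderiv_mul_of_integrable (μ := volume)
      (f := fun _ => (1:ℝ)) (g := h) (v := v) (by simp)
      (by simpa using hh'.integrable_of_hasCompactSupport hhc')
      (by simpa using hh.continuous.integrable_of_hasCompactSupport hhc)
      (by simp) (fun w _ => hh.differentiable (by simp) w)
    simpa using this
  rw [e1, e2, e3, integral_neg, e4, e5, e6, neg_zero]

lemma vt_core {d : ℕ} {𝒳 : Type*} [MeasurableSpace 𝒳] (μ : Measure 𝒳) [SigmaFinite μ]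
    (p : EuclideanSpace ℝ (Fin d) → ℝ) (hp : ContDiff ℝ 1 p) (hp0 : ∀ w, 0 ≤ p w)
    (hp1 : ∫ w, p w = 1)
    (f : EuclideanSpace ℝ (Fin d) → 𝒳 → ℝ)
    (hfmeas : ∀ w, Measurable (f w))
    (hf0 : ∀ w x, 0 ≤ f w x)
    (hf1 : ∀ w, ∫ x, f w x ∂μ = 1)
    (hd : ∀ x, Differentiable ℝ (fun w => f w x))
    (what : 𝒳 → EuclideanSpace ℝ (Fin d)) (hwhat : Measurable what)
    (D : Fin d → EuclideanSpace ℝ (Fin d) → 𝒳 → ℝ)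
    (hD : ∀ i w x, D i w x = fderiv ℝ (fun w' => f w' x) w (EuclideanSpace.single i 1))
    (q : Fin d → EuclideanSpace ℝ (Fin d) → ℝ)
    (hq : ∀ i w, q i w = fderiv ℝ p w (EuclideanSpace.single i 1))
    (hreg2 : ∀ i j : Fin d, ∫ w, ∫ x, ((what x i - w i) * (D j w x * p w + f w x * q j w)
        - (if i = j then 1 else 0) * (f w x * p w)) ∂μ = 0)
    (hfin1 : ∀ w i j, Integrable (fun x => D i w x * D j w x / f w x) μ)
    (hfin2 : ∀ i j, Integrable (fun w => (∫ x, D i w x * D j w x / f w x ∂μ) * p w))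
    (hfin3 : ∀ i j, Integrable (fun w => q i w * q j w / p w))
    (hfin4 : ∀ w i j, Integrable (fun x => (what x i - w i) * (what x j - w j) * f w x) μ)
    (hfin5 : ∀ i j, Integrable (fun w =>
      (∫ x, (what x i - w i) * (what x j - w j) * f w x ∂μ) * p w))
    (M J : Matrix (Fin d) (Fin d) ℝ)
    (hM : ∀ i j, M i j = ∫ w, (∫ x, (what x i - w i) * (what x j - w j) * f w x ∂μ) * p w)
    (hJ : ∀ i j, J i j = (∫ w, (∫ x, D i w x * D j w x / f w x ∂μ) * p w)
      + ∫ w, q i w * q j w / p w)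
    (hu : IsUnit J) : (M - J⁻¹).PosSemidef := by
  have hfi : ∀ w, Integrable (f w) μ := fun w => by
    by_contra h
    have := hf1 w
    rw [integral_undef h] at this
    exact zero_ne_one this
  have hpi : Integrable p := by
    by_contra h
    rw [integral_undef h] at hp1
    exact zero_ne_one hp1
  have hfm : Measurable (fun z : EuclideanSpace ℝ (Fin d) × 𝒳 => f z.1 z.2) :=
    measurable_uncurry_of_continuous_of_measurable (fun x => (hd x).continuous) hfmeas
  have hDm : ∀ i, Measurable (fun z : EuclideanSpace ℝ (Fin d) × 𝒳 => D i z.1 z.2) := by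
    intro i
    simp only [hD]
    exact vt_meas_deriv f hfm hd _
  have hpm : Measurable (fun z : EuclideanSpace ℝ (Fin d) × 𝒳 => p z.1) :=
    hp.continuous.measurable.comp measurable_fst
  have hqm : ∀ i, Measurable (fun z : EuclideanSpace ℝ (Fin d) × 𝒳 => q i z.1) := by
    intro i
    simp only [hq]
    have : Continuous (fun w => fderiv ℝ p w (EuclideanSpace.single i 1)) :=
      (hp.continuous_fderiv (by simp)).clm_apply continuous_const
    exact this.measurable.comp measurable_fst
  have hEm : ∀ i, Measurable (fun z : EuclideanSpace ℝ (Fin d) × 𝒳 => what z.2 i - z.1 i) := by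
    intro i
    have h1 : Measurable (fun y : EuclideanSpace ℝ (Fin d) => y i) := by fun_prop
    exact (h1.comp (hwhat.comp measurable_snd)).sub (h1.comp measurable_fst)
  have hD0 : ∀ i w x, f w x = 0 → D i w x = 0 := by
    intro i w x h
    rw [hD, vt_fderiv_zero (fun w' => f w' x) (fun w' => hf0 w' x) w h]; simp
  have hq0 : ∀ i w, p w = 0 → q i w = 0 := by
    intro i w h
    rw [hq, vt_fderiv_zero p hp0 w h]; simp
  set ν := (volume : Measure (EuclideanSpace ℝ (Fin d))).prod μ with hν
  set R : EuclideanSpace ℝ (Fin d) × 𝒳 → ℝ := fun z => Real.sqrt (f z.1 z.2 * p z.1) with hR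
  have hRR : ∀ z, R z * R z = f z.1 z.2 * p z.1 := fun z =>
    Real.mul_self_sqrt (mul_nonneg (hf0 _ _) (hp0 _))
  have hRm : Measurable R := (hfm.mul hpm).sqrt
  set A : Fin d → EuclideanSpace ℝ (Fin d) × 𝒳 → ℝ := fun i z => (what z.2 i - z.1 i) * R z with hA
  set F : Fin d → EuclideanSpace ℝ (Fin d) × 𝒳 → ℝ := fun i z => D i z.1 z.2 / f z.1 z.2 * R z
    with hF
  set P : Fin d → EuclideanSpace ℝ (Fin d) × 𝒳 → ℝ := fun i z => q i z.1 / p z.1 * R z with hP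
  have pAA i j z : A i z * A j z = (what z.2 i - z.1 i) * (what z.2 j - z.1 j) * f z.1 z.2 * p z.1 := by
    simp only [hA]; linear_combination (what z.2 i - z.1 i) * (what z.2 j - z.1 j) * hRR z
  have pFF i j z : F i z * F j z = D i z.1 z.2 * D j z.1 z.2 / f z.1 z.2 * p z.1 := by
    have : F i z * F j z = D i z.1 z.2 / f z.1 z.2 * (D j z.1 z.2 / f z.1 z.2) * (R z * R z) := by
      simp only [hF]; ring
    rw [this, hRR]
    by_cases h : f z.1 z.2 = 0
    · simp [h]
    · field_simp
  have pPP i j z : P i z * P j z = q i z.1 * q j z.1 / p z.1 * f z.1 z.2 := by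
    have : P i z * P j z = q i z.1 / p z.1 * (q j z.1 / p z.1) * (R z * R z) := by
      simp only [hP]; ring
    rw [this, hRR]
    by_cases h : p z.1 = 0
    · simp [h]
    · field_simp
  have pRF i z : F i z * R z = D i z.1 z.2 * p z.1 := by
    have : F i z * R z = D i z.1 z.2 / f z.1 z.2 * (R z * R z) := by
      simp only [hF]; ring
    rw [this, hRR]
    by_cases h : f z.1 z.2 = 0
    · simp [h, hD0 i _ _ h]
    · field_simp
  have pRP i z : P i z * R z = q i z.1 * f z.1 z.2 := by
    have : P i z * R z = q i z.1 / p z.1 * (R z * R z) := by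
      simp only [hP]; ring
    rw [this, hRR]
    by_cases h : p z.1 = 0
    · simp [h, hq0 i _ h]
    · field_simp
  have pFP i j z : F i z * P j z = q j z.1 / p z.1 * (D i z.1 z.2 * p z.1) := by
    rw [← pRF]; simp only [hP]; ring
  have pAF i j z : A i z * F j z = (what z.2 i - z.1 i) * (D j z.1 z.2 * p z.1) := by
    rw [← pRF]; simp only [hA]; ring
  have pAP i j z : A i z * P j z = (what z.2 i - z.1 i) * (f z.1 z.2 * q j z.1) := by
    rw [mul_comm (f z.1 z.2), ← pRP]; simp only [hA]; ring
  -- square integrability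
  have mR : MemLp R 2 ν := by
    rw [memLp_two_iff_integrable_sq hRm.aestronglyMeasurable]
    simp only [sq, hRR]
    refine vt_int_prod μ (fun w x => f w x * p w) (hfm.mul hpm)
      (fun w x => mul_nonneg (hf0 _ _) (hp0 _)) (fun w => (hfi w).mul_const _) ?_
    simpa only [integral_mul_const, hf1, one_mul] using hpi
  have mA i : MemLp (A i) 2 ν := by
    have hms : Measurable (A i) := ((hEm i).mul hRm)
    rw [memLp_two_iff_integrable_sq hms.aestronglyMeasurable]
    simp only [sq, pAA]
    refine vt_int_prod μ (fun w x => (what x i - w i) * (what x i - w i) * f w x * p w)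
      ((((hEm i).mul (hEm i)).mul hfm).mul hpm)
      (fun w x => mul_nonneg (mul_nonneg (mul_self_nonneg _) (hf0 _ _)) (hp0 _))
      (fun w => (hfin4 w i i).mul_const _) ?_
    simpa only [integral_mul_const] using hfin5 i i
  have mF i : MemLp (F i) 2 ν := by
    have hms : Measurable (F i) := (((hDm i).div hfm).mul hRm)
    rw [memLp_two_iff_integrable_sq hms.aestronglyMeasurable]
    simp only [sq, pFF]
    refine vt_int_prod μ (fun w x => D i w x * D i w x / f w x * p w)
      ((((hDm i).mul (hDm i)).div hfm).mul hpm)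
      (fun w x => mul_nonneg (div_nonneg (mul_self_nonneg _) (hf0 _ _)) (hp0 _))
      (fun w => (hfin1 w i i).mul_const _) ?_
    simpa only [integral_mul_const] using hfin2 i i
  have mP i : MemLp (P i) 2 ν := by
    have hms : Measurable (P i) := (((hqm i).div hpm).mul hRm)
    rw [memLp_two_iff_integrable_sq hms.aestronglyMeasurable]
    simp only [sq, pPP]
    refine vt_int_prod μ (fun w x => q i w * q i w / p w * f w x)
      ((((hqm i).mul (hqm i)).div hpm).mul hfm)
      (fun w x => mul_nonneg (div_nonneg (mul_self_nonneg _) (hp0 _)) (hf0 _ _))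
      (fun w => (hfi w).const_mul _) ?_
    simpa only [integral_const_mul, hf1, mul_one] using hfin3 i i
  have iAA i j : Integrable (fun z => A i z * A j z) ν := (mA i).integrable_mul (mA j)
  have iAF i j : Integrable (fun z => A i z * F j z) ν := (mA i).integrable_mul (mF j)
  have iAP i j : Integrable (fun z => A i z * P j z) ν := (mA i).integrable_mul (mP j)
  have iFF i j : Integrable (fun z => F i z * F j z) ν := (mF i).integrable_mul (mF j)
  have iPP i j : Integrable (fun z => P i z * P j z) ν := (mP i).integrable_mul (mP j)
  have iFP i j : Integrable (fun z => F i z * P j z) ν := (mF i).integrable_mul (mP j)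
  have iFR i : Integrable (fun z => F i z * R z) ν := (mF i).integrable_mul mR
  have iRR : Integrable (fun z => R z * R z) ν := mR.integrable_mul mR
  -- the cross terms vanish
  have cross i j : ∫ z, F i z * P j z ∂ν = 0 := by
    rw [integral_prod _ (iFP i j)]
    simp only [pFP, integral_const_mul]
    have hs := vt_score μ p hp f hfm hf0 hfi hf1 hd (EuclideanSpace.single i 1)
      (by simpa only [pRF, hD] using iFR i)
    rw [← integral_zero (EuclideanSpace ℝ (Fin d)) ℝ]
    refine integral_congr_ae ?_
    filter_upwards [hs] with w hw
    simp only [hD, hw, mul_zero]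
  have vFF i j : ∫ z, F i z * F j z ∂ν = ∫ w, (∫ x, D i w x * D j w x / f w x ∂μ) * p w := by
    rw [integral_prod _ (iFF i j)]
    simp only [pFF, integral_mul_const]
  have vPP i j : ∫ z, P i z * P j z ∂ν = ∫ w, q i w * q j w / p w := by
    rw [integral_prod _ (iPP i j)]
    simp only [pPP, integral_const_mul, hf1, mul_one]
  refine vt_psd ν A (fun i z => F i z + P i z) mA (fun i => (mF i).add (mP i)) M J ?_ ?_ ?_ hu
  · intro i j
    rw [integral_prod _ (iAA i j), hM]
    simp only [pAA, integral_mul_const]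
  · intro i j
    have e : ∀ z, (F i z + P i z) * (F j z + P j z) =
      (F i z * F j z + P i z * P j z) + (F i z * P j z + F j z * P i z) := fun z => by ring
    simp only [e]
    have k1 : Integrable (fun z => F i z * F j z + P i z * P j z) ν := (iFF i j).add (iPP i j)
    have k2 : Integrable (fun z => F i z * P j z + F j z * P i z) ν := (iFP i j).add (iFP j i)
    rw [integral_add k1 k2,
      integral_add (iFF i j) (iPP i j), integral_add (iFP i j) (iFP j i), cross, cross, vFF, vPP, hJ]
    ring
  · intro i j
    have e : ∀ z, A i z * (F j z + P j z) = ((A i z * F j z + A i z * P j z)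
        - (if i = j then 1 else 0) * (R z * R z)) + (if i = j then 1 else 0) * (R z * R z) :=
      fun z => by ring
    have k1 : Integrable (fun z => (A i z * F j z + A i z * P j z)
        - (if i = j then 1 else 0) * (R z * R z)) ν :=
      ((iAF i j).add (iAP i j)).sub (iRR.const_mul _)
    have k2 : ∫ z, ((A i z * F j z + A i z * P j z)
        - (if i = j then 1 else 0) * (R z * R z)) ∂ν = 0 := by
      rw [integral_prod _ k1]
      have := hreg2 i j
      simp only [mul_add] at this
      simpa only [pAF, pAP, hRR] using this
    have k3 : ∫ z, R z * R z ∂ν = 1 := by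
      rw [integral_prod _ iRR]
      simp only [hRR, integral_mul_const, hf1, one_mul, hp1]
    simp only [e]
    rw [integral_add k1 (iRR.const_mul _), k2, integral_const_mul, k3]
    ring

/-- Multivariate Bayesian Cramér–Rao / van Trees inequality. Let `W ⊂ ℝ^d`
be compact, `prior` a `C¹` probability density supported on `W` and vanishing on its
boundary, and `{f_w}` a family of probability densities on a sample space `𝒳` (w.r.t. a
measure `μ`), differentiable in `w`. With the Fisher information `𝓘(w)`, the prior
information `𝓘(π)`, and the stated regularity conditions (differentiation under the
integral, integration by parts, finiteness of the displayed integrals, and invertibility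
of `E_{w∼π}𝓘(w) + 𝓘(π)`), every measurable estimator `ŵ : 𝒳 → ℝ^d` satisfies
`E_{w∼π} E_{X∼f_w}[(ŵ−w)(ŵ−w)ᵀ] ⪰ (E_{w∼π}𝓘(w) + 𝓘(π))⁻¹`. -/
theorem van_trees_inequality {d : ℕ} {𝒳 : Type} [MeasurableSpace 𝒳] (μ : Measure 𝒳)
    (W : Set (EuclideanSpace ℝ (Fin d))) (hWcompact : IsCompact W)
    (prior : EuclideanSpace ℝ (Fin d) → ℝ)
    (hpriorC1 : ContDiff ℝ 1 prior)
    (hpriornonneg : ∀ w, 0 ≤ prior w)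
    (hpriorint : ∫ w, prior w = 1)
    (hpriorsupp : ∀ w ∉ W, prior w = 0)
    (hpriorbd : ∀ w ∈ frontier W, prior w = 0)
    (f : EuclideanSpace ℝ (Fin d) → 𝒳 → ℝ)
    (hfmeas : ∀ w, Measurable (f w))
    (hfnonneg : ∀ w x, 0 ≤ f w x)
    (hfint : ∀ w, ∫ x, f w x ∂μ = 1)
    (hfdiff : ∀ x, Differentiable ℝ (fun w => f w x))
    (what : 𝒳 → EuclideanSpace ℝ (Fin d)) (hwhat : Measurable what)
    -- the Fisher information matrix of `f_w`
    (I : EuclideanSpace ℝ (Fin d) → Matrix (Fin d) (Fin d) ℝ)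
    (hI : ∀ w, I w = Matrix.of fun i j =>
      ∫ x, gradient (fun w' => Real.log (f w' x)) w i *
        gradient (fun w' => Real.log (f w' x)) w j * f w x ∂μ)
    -- the information matrix of the prior
    (Iprior : Matrix (Fin d) (Fin d) ℝ)
    (hIprior : Iprior = Matrix.of fun i j =>
      ∫ w, gradient (fun w' => Real.log (prior w')) w i *
        gradient (fun w' => Real.log (prior w')) w j * prior w)
    -- the average Fisher information `E_{w∼π} 𝓘(w)`
    (EI : Matrix (Fin d) (Fin d) ℝ)
    (hEI : EI = Matrix.of fun i j => ∫ w, I w i j * prior w)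
    -- regularity: differentiation under the integral sign
    (hreg1 : ∀ w, fderiv ℝ (fun w' => ∫ x, f w' x ∂μ) w = 0)
    -- regularity: integration-by-parts identity
    (hreg2 : ∀ i j : Fin d,
      ∫ w, ∫ x, fderiv ℝ (fun w' => (what x i - w' i) * f w' x * prior w') w
        (EuclideanSpace.single j 1) ∂μ = 0)
    -- finiteness of the displayed integrals
    (hfin1 : ∀ w i j, Integrable (fun x =>
      gradient (fun w' => Real.log (f w' x)) w i *
        gradient (fun w' => Real.log (f w' x)) w j * f w x) μ)
    (hfin2 : ∀ i j, Integrable (fun w => I w i j * prior w))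
    (hfin3 : ∀ i j, Integrable (fun w =>
      gradient (fun w' => Real.log (prior w')) w i *
        gradient (fun w' => Real.log (prior w')) w j * prior w))
    (hfin4 : ∀ w i j, Integrable (fun x =>
      (what x i - w i) * (what x j - w j) * f w x) μ)
    (hfin5 : ∀ i j, Integrable (fun w =>
      (∫ x, (what x i - w i) * (what x j - w j) * f w x ∂μ) * prior w))
    -- invertibility
    (hinv : IsUnit (EI + Iprior)) :
    ((Matrix.of fun i j =>
        ∫ w, (∫ x, (what x i - w i) * (what x j - w j) * f w x ∂μ) * prior w) -
      (EI + Iprior)⁻¹).PosSemidef := by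
  have hfi : ∀ w, Integrable (f w) μ := fun w => by
    by_contra h
    have := hfint w
    rw [integral_undef h] at this
    exact zero_ne_one this
  set u := TopologicalSpace.denseSeq (EuclideanSpace ℝ (Fin d)) with hu
  have hsf := vt_sfin μ (fun n => f (u n)) (fun n => hfi _) (fun n => hfmeas _)
  set S : Set 𝒳 := ⋃ n, {x | f (u n) x ≠ 0} with hS
  have hSf : ∀ x, x ∉ S → (fun w => f w x) = fun _ => 0 := by
    intro x hx
    refine Continuous.ext_on (TopologicalSpace.denseRange_denseSeq _) (hfdiff x).continuous
      continuous_const ?_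
    rintro _ ⟨n, rfl⟩
    by_contra h
    exact hx (Set.mem_iUnion.2 ⟨n, h⟩)
  have hSf' : ∀ x, x ∉ S → ∀ w, f w x = 0 := fun x hx w => congrFun (hSf x hx) w
  set D : Fin d → EuclideanSpace ℝ (Fin d) → 𝒳 → ℝ := fun i w x =>
    fderiv ℝ (fun w' => f w' x) w (EuclideanSpace.single i 1) with hD
  set q : Fin d → EuclideanSpace ℝ (Fin d) → ℝ := fun i w =>
    fderiv ℝ prior w (EuclideanSpace.single i 1) with hq
  have hSD : ∀ x, x ∉ S → ∀ i w, D i w x = 0 := by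
    intro x hx i w
    simp only [hD, hSf x hx]
    simp
  have hgf : ∀ i j w x, gradient (fun w' => Real.log (f w' x)) w i *
        gradient (fun w' => Real.log (f w' x)) w j * f w x = D i w x * D j w x / f w x :=
    fun i j w x => vt_gradlog (fun w' => f w' x) w (hfdiff x w) i j
  have hpd : Differentiable ℝ prior := hpriorC1.differentiable (by simp)
  have hgp : ∀ i j w, gradient (fun w' => Real.log (prior w')) w i *
        gradient (fun w' => Real.log (prior w')) w j * prior w = q i w * q j w / prior w :=
    fun i j w => vt_gradlog prior w (hpd w) i j
  have hder : ∀ i j w x, fderiv ℝ (fun w' => (what x i - w' i) * f w' x * prior w') w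
        (EuclideanSpace.single j 1) = (what x i - w i) * (D j w x * prior w + f w x * q j w)
        - (if i = j then 1 else 0) * (f w x * prior w) := by
    intro i j w x
    have h1 : HasFDerivAt (fun w' : EuclideanSpace ℝ (Fin d) => what x i - w' i)
        (-(EuclideanSpace.proj i : EuclideanSpace ℝ (Fin d) →L[ℝ] ℝ)) w :=
      (EuclideanSpace.proj i : EuclideanSpace ℝ (Fin d) →L[ℝ] ℝ).hasFDerivAt.const_sub _
    have h2 := (h1.mul (hfdiff x w).hasFDerivAt).mul (hpd w).hasFDerivAt
    have h3 : fderiv ℝ (fun w' => (what x i - w' i) * f w' x * prior w') w = _ := h2.fderiv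
    have hpr : (EuclideanSpace.proj i : EuclideanSpace ℝ (Fin d) →L[ℝ] ℝ)
        (EuclideanSpace.single j 1) = if i = j then 1 else 0 := by
      simp [PiLp.single_apply]
    rw [h3]
    simp only [hD, hq, ContinuousLinearMap.add_apply, ContinuousLinearMap.smul_apply,
      ContinuousLinearMap.neg_apply, smul_eq_mul, hpr,
      Pi.mul_apply]
    ring
  have hres : ∀ G : 𝒳 → ℝ, (∀ x, x ∉ S → G x = 0) →
      ∫ x, G x ∂(μ.restrict S) = ∫ x, G x ∂μ :=
    fun G hG => setIntegral_eq_integral_of_forall_compl_eq_zero hG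
  have r1 : ∀ w, ∫ x, f w x ∂(μ.restrict S) = ∫ x, f w x ∂μ :=
    fun w => hres _ fun x hx => hSf' x hx w
  have r2 : ∀ i j w, ∫ x, D i w x * D j w x / f w x ∂(μ.restrict S)
      = ∫ x, D i w x * D j w x / f w x ∂μ :=
    fun i j w => hres _ fun x hx => by simp [hSf' x hx w]
  have r3 : ∀ i j w, ∫ x, (what x i - w i) * (what x j - w j) * f w x ∂(μ.restrict S)
      = ∫ x, (what x i - w i) * (what x j - w j) * f w x ∂μ :=
    fun i j w => hres _ fun x hx => by simp [hSf' x hx w]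
  have r4 : ∀ i j w, ∫ x, ((what x i - w i) * (D j w x * prior w + f w x * q j w)
        - (if i = j then 1 else 0) * (f w x * prior w)) ∂(μ.restrict S)
      = ∫ x, ((what x i - w i) * (D j w x * prior w + f w x * q j w)
        - (if i = j then 1 else 0) * (f w x * prior w)) ∂μ :=
    fun i j w => hres _ fun x hx => by simp [hSf' x hx w, hSD x hx]
  have hIij : ∀ w i j, I w i j = ∫ x, D i w x * D j w x / f w x ∂μ := by
    intro w i j
    rw [hI]
    simp only [Matrix.of_apply, hgf]
  refine vt_core (μ.restrict S) prior hpriorC1 hpriornonneg hpriorint f hfmeas hfnonneg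
    (fun w => by rw [r1, hfint]) hfdiff what hwhat D (fun _ _ _ => rfl) q (fun _ _ => rfl)
    ?_ ?_ ?_ ?_ ?_ ?_ _ _ ?_ ?_ hinv
  · intro i j
    simp only [r4]
    simpa only [hder] using hreg2 i j
  · intro w i j
    have := hfin1 w i j
    simp only [hgf] at this
    exact this.restrict
  · intro i j
    simp only [r2]
    simpa only [hIij] using hfin2 i j
  · intro i j
    simpa only [hgp] using hfin3 i j
  · exact fun w i j => (hfin4 w i j).restrict
  · intro i j
    simp only [r3]
    exact hfin5 i j
  · intro i j
    simp only [r3, Matrix.of_apply]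
  · intro i j
    simp only [r2, hEI, hIprior, Matrix.add_apply, Matrix.of_apply, hgp, hIij]

end
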